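/- For every integer n with 1 ≤ n ≤ (g+1)/2, the variable x_n does not lie in I; that is, the image of x_n in 𝓡 = R/I is nonzero. -/

import Mathlib

/- We model `R = ℚ[x₁, x₂, …]` as `MvPolynomial ℕ ℚ`, the variable of index `v`
representing `x_{v+1}` (so `x_k = X (k-1)` for `k ≥ 1`). -/

open MvPolynomial

noncomputable section

/-- Codimension grading: `codim x_{v+1} = v + 1`. -/
def codimW (d : ℕ →₀ ℕ) : ℕ := d.sum fun v e => (v + 1) * e

/-- Level grading: `ℓ(x_{v+1}) = v`. -/
def levelW (d : ℕ →₀ ℕ) : ℕ := d.sum fun v e => v * e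

/-- `R^i_{(j)}`: the ℚ-span of the monomials of codimension `i` and level `j`. -/
def Rij (i j : ℕ) : Submodule ℚ (MvPolynomial ℕ ℚ) :=
  Submodule.span ℚ
    { p | ∃ d : ℕ →₀ ℕ, codimW d = i ∧ levelW d = j ∧ p = monomial d (1 : ℚ) }

/-- Polishchuk's operator
`𝒟 = -g ∂₁ + (1/2) ∑_{m,n ≥ 1} binom(m+n, n) x_{m+n-1} ∂_m ∂_n`; in our indexing,
with `a = m−1`, `b = n−1`, the second term is
`(1/2) ∑_{a,b ≥ 0} binom(a+b+2, b+1) X(a+b) ∂_{X a} ∂_{X b}`.  On a given polynomial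
`p` only the finitely many terms with both variables occurring in `p` are nonzero, so
the sum may be cut off beyond all variable indices of `p`. -/
def Dop (g : ℕ) (p : MvPolynomial ℕ ℚ) : MvPolynomial ℕ ℚ :=
  -(g : ℚ) • pderiv 0 p +
    (1/2 : ℚ) •
      ∑ a ∈ Finset.range (p.vars.sup id + 1), ∑ b ∈ Finset.range (p.vars.sup id + 1),
        (((a + b + 2).choose (b + 1) : ℚ)) • (X (a + b) * pderiv a (pderiv b p))

/-- `R^{>g}`: span of monomials of codimension `> g`. -/
def Rgt (g : ℕ) : Submodule ℚ (MvPolynomial ℕ ℚ) :=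
  Submodule.span ℚ { p | ∃ d : ℕ →₀ ℕ, g < codimW d ∧ p = monomial d (1 : ℚ) }

/-- `Fil¹R^g`: span of monomials of codimension `g` and level `≥ 1`. -/
def Fil1Rg (g : ℕ) : Submodule ℚ (MvPolynomial ℕ ℚ) :=
  Submodule.span ℚ
    { p | ∃ d : ℕ →₀ ℕ, codimW d = g ∧ 1 ≤ levelW d ∧ p = monomial d (1 : ℚ) }

/-- Polishchuk's ideal of universal relations `I = R^{>g} + ∑_{n ≥ 0} 𝒟ⁿ(Fil¹R^g)`. -/
def Ipol (g : ℕ) : Submodule ℚ (MvPolynomial ℕ ℚ) :=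
  Rgt g ⊔ ⨆ n : ℕ, Submodule.span ℚ ((Dop g)^[n] '' (Fil1Rg g : Set (MvPolynomial ℕ ℚ)))

/-- The truncation of Polishchuk's operator to the variables of index at most `N`. -/
def truncatedDop (g N : ℕ) : MvPolynomial ℕ ℚ →ₗ[ℚ] MvPolynomial ℕ ℚ :=
  -(g : ℚ) • (pderiv 0).toLinearMap +
    (1/2 : ℚ) • ∑ a ∈ Finset.range (N + 1), ∑ b ∈ Finset.range (N + 1),
      (((a + b + 2).choose (b + 1) : ℚ)) •
        (LinearMap.mulLeft ℚ (X (a + b)) ∘ₗ (pderiv a).toLinearMap ∘ₗ (pderiv b).toLinearMap)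

lemma truncatedDop_apply (g N : ℕ) (p : MvPolynomial ℕ ℚ) :
    truncatedDop g N p = -(g : ℚ) • pderiv 0 p +
      (1/2 : ℚ) • ∑ a ∈ Finset.range (N + 1), ∑ b ∈ Finset.range (N + 1),
        (((a + b + 2).choose (b + 1) : ℚ)) • (X (a + b) * pderiv a (pderiv b p)) := by
  simp [truncatedDop, LinearMap.sum_apply]

lemma pderiv_pderiv_comm (a b : ℕ) (p : MvPolynomial ℕ ℚ) :
    pderiv a (pderiv b p) = pderiv b (pderiv a p) := by
  have h : ⁅pderiv (R := ℚ) a, pderiv (R := ℚ) b⁆ = 0 := by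
    refine derivation_ext fun i => ?_
    simp [Derivation.commutator_apply, pderiv_X, Pi.single_apply, apply_ite]
  have := DFunLike.congr_fun h p
  simpa [Derivation.commutator_apply, sub_eq_zero] using this

lemma Dop_eq_truncatedDop (g : ℕ) {N : ℕ} {p : MvPolynomial ℕ ℚ} (hN : p.vars.sup id ≤ N) :
    Dop g p = truncatedDop g N p := by
  have hvars : ∀ i, i ∉ Finset.range (p.vars.sup id + 1) → i ∉ p.vars := fun i hi hip =>
    hi (Finset.mem_range_succ_iff.2 (Finset.le_sup (f := id) hip))
  have hsub : Finset.range (p.vars.sup id + 1) ⊆ Finset.range (N + 1) :=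
    Finset.range_subset_range.2 (by omega)
  rw [truncatedDop_apply, Dop]
  congr 2
  rw [Finset.sum_subset hsub]
  · refine Finset.sum_congr rfl fun a _ => Finset.sum_subset hsub fun b _ hb => ?_
    rw [pderiv_eq_zero_of_notMem_vars (hvars b hb)]
    simp
  · refine fun a _ ha => Finset.sum_eq_zero fun b _ => ?_
    rw [pderiv_pderiv_comm, pderiv_eq_zero_of_notMem_vars (hvars a ha)]
    simp

/-- Polishchuk's operator as a linear endomorphism. -/
def linearDop (g : ℕ) : Module.End ℚ (MvPolynomial ℕ ℚ) where
  toFun := Dop g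
  map_add' p q := by
    obtain ⟨N, hN⟩ : ∃ N, N = max ((p + q).vars.sup id) (max (p.vars.sup id) (q.vars.sup id)) :=
      ⟨_, rfl⟩
    rw [Dop_eq_truncatedDop g (p := p + q) (N := N) (by omega),
      Dop_eq_truncatedDop g (p := p) (N := N) (by omega),
      Dop_eq_truncatedDop g (p := q) (N := N) (by omega), map_add]
  map_smul' c p := by
    obtain ⟨N, hN⟩ : ∃ N, N = max ((c • p).vars.sup id) (p.vars.sup id) := ⟨_, rfl⟩
    rw [Dop_eq_truncatedDop g (p := c • p) (N := N) (by omega),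
      Dop_eq_truncatedDop g (p := p) (N := N) (by omega), map_smul, RingHom.id_apply]

lemma linearDop_eq_truncatedDop (g : ℕ) {N : ℕ} {p : MvPolynomial ℕ ℚ}
    (hN : p.vars.sup id ≤ N) : linearDop g p = truncatedDop g N p :=
  Dop_eq_truncatedDop g hN

/-- The Euler derivation `x_v ↦ w v • x_v` attached to a weight `w`. -/
def euler (w : ℕ → ℚ) : Derivation ℚ (MvPolynomial ℕ ℚ) (MvPolynomial ℕ ℚ) :=
  mkDerivation ℚ fun v => w v • X v

@[simp]
lemma euler_X (w : ℕ → ℚ) (v : ℕ) : euler w (X v) = w v • X v :=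
  mkDerivation_X _ _ _

lemma euler_monomial (w : ℕ → ℚ) (d : ℕ →₀ ℕ) (c : ℚ) :
    euler w (monomial d c) = (d.sum fun v e => (e : ℚ) * w v) • monomial d c := by
  rw [euler, mkDerivation_monomial, Finsupp.sum, Finsupp.sum, Finset.smul_sum, Finset.sum_smul]
  refine Finset.sum_congr rfl fun v hv => ?_
  have hle : Finsupp.single v 1 ≤ d := by
    simpa [Finsupp.single_le_iff, Nat.one_le_iff_ne_zero] using hv
  rw [smul_eq_mul, mul_smul_comm, X, monomial_mul, tsub_add_cancel_of_le hle]
  simp only [smul_monomial, smul_eq_mul, mul_one]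
  congr 1
  ring

lemma coeff_euler (w : ℕ → ℚ) (d : ℕ →₀ ℕ) (p : MvPolynomial ℕ ℚ) :
    coeff d (euler w p) = (d.sum fun v e => (e : ℚ) * w v) * coeff d p := by
  induction p using MvPolynomial.induction_on' with
  | monomial u c =>
    rw [euler_monomial, coeff_smul, coeff_monomial]
    split_ifs with h <;> simp [h]
  | add p q hp hq => rw [map_add, coeff_add, hp, hq, coeff_add, mul_add]

lemma euler_pderiv (w : ℕ → ℚ) (a : ℕ) (p : MvPolynomial ℕ ℚ) :
    euler w (pderiv a p) = pderiv a (euler w p) - w a • pderiv a p := by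
  have h : ⁅euler w, pderiv (R := ℚ) a⁆ = -(w a • pderiv a) := by
    refine derivation_ext fun i => ?_
    by_cases hi : i = a
    · subst hi; simp [Derivation.commutator_apply]
    · simp [Derivation.commutator_apply, pderiv_X_of_ne hi]
  have := DFunLike.congr_fun h p
  simp only [Derivation.commutator_apply, Derivation.neg_apply, Derivation.smul_apply] at this
  rw [sub_eq_iff_eq_add.1 this]
  abel

lemma euler_truncatedDop (g N : ℕ) {w : ℕ → ℚ} (hw : ∀ a b, w (a + b) = w a + w b - w 0)
    (p : MvPolynomial ℕ ℚ) :
    euler w (truncatedDop g N p) =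
      truncatedDop g N (euler w p) - w 0 • truncatedDop g N p := by
  have key : ∀ a b : ℕ, euler w (X (a + b) * pderiv a (pderiv b p)) =
      X (a + b) * pderiv a (pderiv b (euler w p)) -
        w 0 • (X (a + b) * pderiv a (pderiv b p)) := by
    intro a b
    simp only [Derivation.leibniz, euler_X, euler_pderiv, map_sub, hw, smul_eq_mul, MvPolynomial.smul_eq_C_mul,
      map_add, pderiv_C]
    ring
  simp only [truncatedDop_apply, map_add, Derivation.map_smul, map_sum, key, euler_pderiv,
    smul_sub, Finset.sum_sub_distrib, smul_add, Finset.smul_sum, smul_comm (w 0)]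
  abel

lemma euler_linearDop (g : ℕ) (α β : ℚ) (p : MvPolynomial ℕ ℚ) :
    euler (fun v => α + β * v) (linearDop g p) =
      linearDop g (euler (fun v => α + β * v) p) - α • linearDop g p := by
  obtain ⟨N, hN⟩ : ∃ N, N = max (p.vars.sup id)
      ((euler (fun v => α + β * v) p).vars.sup id) := ⟨_, rfl⟩
  rw [linearDop_eq_truncatedDop g (p := p) (N := N) (by omega),
    linearDop_eq_truncatedDop g (p := euler _ p) (N := N) (by omega),
    euler_truncatedDop g N (by intros; push_cast; ring)]
  simp

lemma euler_linearDop_pow (g : ℕ) (α β c : ℚ) {p : MvPolynomial ℕ ℚ}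
    (hp : euler (fun v => α + β * v) p = c • p) (k : ℕ) :
    euler (fun v => α + β * v) ((linearDop g ^ k) p) = (c - k * α) • (linearDop g ^ k) p := by
  induction k with
  | zero => simpa using hp
  | succ k ih =>
    rw [pow_succ', Module.End.mul_apply, euler_linearDop, ih, map_smul, ← sub_smul]
    push_cast
    ring_nf

lemma derivation_sum_apply {ι : Type*} (s : Finset ι)
    (D : ι → Derivation ℚ (MvPolynomial ℕ ℚ) (MvPolynomial ℕ ℚ)) (p : MvPolynomial ℕ ℚ) :
    (∑ i ∈ s, D i) p = ∑ i ∈ s, D i p := by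
  rw [← Finset.sum_apply]
  exact congrFun (map_sum Derivation.coeFnAddMonoidHom D s) p

lemma euler_eq_sum_pderiv (w : ℕ → ℚ) {N : ℕ} {p : MvPolynomial ℕ ℚ}
    (hN : p.vars.sup id ≤ N) :
    euler w p = ∑ v ∈ Finset.range (N + 1), w v • (X v * pderiv v p) := by
  have h : euler w p =
      (∑ v ∈ Finset.range (N + 1), w v • (X v : MvPolynomial ℕ ℚ) • pderiv v) p := by
    refine derivation_eq_of_forall_mem_vars fun i hi => ?_
    have hiN : i ∈ Finset.range (N + 1) :=
      Finset.mem_range_succ_iff.2 ((Finset.le_sup (f := id) hi).trans hN)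
    simp only [euler_X, derivation_sum_apply, Derivation.smul_apply]
    rw [Finset.sum_eq_single_of_mem i hiN]
    · simp
    · intro j _ hj
      simp [pderiv_X_of_ne hj.symm]
  rw [h]
  simp [derivation_sum_apply]

lemma truncatedDop_X_zero_mul (g N : ℕ) (p : MvPolynomial ℕ ℚ) :
    truncatedDop g N (X 0 * p) = X 0 * truncatedDop g N p - (g : ℚ) • p +
      ∑ v ∈ Finset.range (N + 1), ((2 : ℚ) + 1 * v) • (X v * pderiv v p) := by
  have key : ∀ a b : ℕ, pderiv a (pderiv b (X 0 * p)) = X 0 * pderiv a (pderiv b p) +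
      ((if b = 0 then pderiv a p else 0) + (if a = 0 then pderiv b p else 0)) := by
    intro a b
    rcases Nat.eq_zero_or_pos a with rfl | ha <;> rcases Nat.eq_zero_or_pos b with rfl | hb
    · simp
      ring
    · simp [pderiv_X_of_ne hb.ne, hb.ne']
    · simp [pderiv_X_of_ne ha.ne, ha.ne']
    · simp [pderiv_X_of_ne ha.ne, pderiv_X_of_ne hb.ne, ha.ne', hb.ne']
  have h0 : (0 : ℕ) ∈ Finset.range (N + 1) := by simp
  simp only [truncatedDop_apply, key, mul_add, smul_add, Finset.sum_add_distrib]
  have h1 : ∑ a ∈ Finset.range (N + 1), ∑ b ∈ Finset.range (N + 1),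
      ((a + b + 2).choose (b + 1) : ℚ) •
        ((X (a + b) : MvPolynomial ℕ ℚ) * if b = 0 then pderiv a p else 0) =
      ∑ v ∈ Finset.range (N + 1), ((2 : ℚ) + 1 * v) • (X v * pderiv v p) := by
    refine Finset.sum_congr rfl fun a _ => ?_
    rw [Finset.sum_eq_single_of_mem 0 h0 (fun b _ hb => by simp [hb])]
    simp [add_comm]
  have h2 : ∑ a ∈ Finset.range (N + 1), ∑ b ∈ Finset.range (N + 1),
      ((a + b + 2).choose (b + 1) : ℚ) •
        ((X (a + b) : MvPolynomial ℕ ℚ) * if a = 0 then pderiv b p else 0) =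
      ∑ v ∈ Finset.range (N + 1), ((2 : ℚ) + 1 * v) • (X v * pderiv v p) := by
    rw [Finset.sum_eq_single_of_mem 0 h0 (fun a _ ha => by simp [ha])]
    refine Finset.sum_congr rfl fun b _ => ?_
    have : (b + 2).choose (b + 1) = b + 2 := Nat.choose_succ_self_right (b + 1)
    rw [zero_add, this, if_pos rfl]
    push_cast
    module
  rw [h1, h2]
  simp only [Derivation.leibniz, pderiv_X_self, smul_eq_mul, mul_one, Finset.mul_sum,
    mul_smul_comm, mul_left_comm (X 0 : MvPolynomial ℕ ℚ), smul_add]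
  module

lemma linearDop_X_zero_mul (g : ℕ) (p : MvPolynomial ℕ ℚ) :
    linearDop g (X 0 * p) =
      X 0 * linearDop g p - (g : ℚ) • p + euler (fun v => 2 + 1 * v) p := by
  obtain ⟨N, hN⟩ : ∃ N, N = max (p.vars.sup id) ((X 0 * p).vars.sup id) := ⟨_, rfl⟩
  rw [linearDop_eq_truncatedDop g (p := p) (N := N) (by omega),
    linearDop_eq_truncatedDop g (p := X 0 * p) (N := N) (by omega),
    euler_eq_sum_pderiv _ (N := N) (by omega), truncatedDop_X_zero_mul]

/-- The `sl₂`-commutation relation between powers of `𝒟` and multiplication by `x₁`. -/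
lemma linearDop_pow_X_zero_mul (g : ℕ) {c : ℚ} {p : MvPolynomial ℕ ℚ}
    (hp : euler (fun v => 2 + 1 * v) p = c • p) (k : ℕ) :
    (linearDop g ^ (k + 1)) (X 0 * p) = X 0 * (linearDop g ^ (k + 1)) p +
      ((k + 1) * (c - g - k)) • (linearDop g ^ k) p := by
  induction k with
  | zero =>
    rw [zero_add, pow_one, linearDop_X_zero_mul, hp]
    simp
    module
  | succ k ih =>
    rw [pow_succ' _ (k + 1), Module.End.mul_apply, ih, map_add, linearDop_X_zero_mul,
      euler_linearDop_pow g 2 1 c hp, map_smul, ← Module.End.mul_apply, ← pow_succ',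
      ← Module.End.mul_apply, ← pow_succ']
    push_cast
    module

lemma sum_affine_weight (α β : ℚ) (d : ℕ →₀ ℕ) :
    (d.sum fun v e => (e : ℚ) * (α + β * v)) = α * (d.degree : ℚ) + β * levelW d := by
  simp only [Finsupp.sum, Finsupp.degree_apply, levelW, Nat.cast_sum, Finset.mul_sum,
    ← Finset.sum_add_distrib]
  exact Finset.sum_congr rfl fun v _ => by push_cast; ring

lemma codimW_eq_levelW_add_degree (d : ℕ →₀ ℕ) : codimW d = levelW d + d.degree := by
  simp only [codimW, levelW, Finsupp.sum, Finsupp.degree_apply, ← Finset.sum_add_distrib]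
  exact Finset.sum_congr rfl fun v _ => by ring

lemma degree_le_levelW {d : ℕ →₀ ℕ} (h : d 0 = 0) : d.degree ≤ levelW d := by
  rw [Finsupp.degree_apply]
  refine Finset.sum_le_sum fun v hv => Nat.le_mul_of_pos_left _ (Nat.pos_of_ne_zero ?_)
  rintro rfl
  exact Finsupp.mem_support_iff.1 hv h

lemma euler_affine_monomial (α β : ℚ) (d : ℕ →₀ ℕ) :
    euler (fun v => α + β * v) (monomial d 1) =
      (α * (d.degree : ℚ) + β * levelW d) • monomial d 1 := by
  rw [euler_monomial, sum_affine_weight]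

/-- The coefficients of `𝒟ᵏ` of a monomial respect the degree and level gradings. -/
lemma degree_levelW_of_coeff_linearDop_pow_ne_zero (g k : ℕ) {d e : ℕ →₀ ℕ}
    (h : coeff e ((linearDop g ^ k) (monomial d 1)) ≠ 0) :
    e.degree + k = d.degree ∧ levelW e = levelW d := by
  have key : ∀ α β : ℚ, α * (e.degree : ℚ) + β * levelW e =
      α * (d.degree : ℚ) + β * levelW d - k * α := by
    intro α β
    have := congrArg (coeff e) (euler_linearDop_pow g α β _ (euler_affine_monomial α β d) k)
    rw [coeff_euler, sum_affine_weight, coeff_smul, smul_eq_mul] at this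
    exact mul_right_cancel₀ h this
  have h1 := key 1 0
  have h2 := key 0 1
  constructor
  · have : ((e.degree + k : ℕ) : ℚ) = (d.degree : ℕ) := by push_cast; linarith
    exact_mod_cast this
  · have : (levelW e : ℚ) = levelW d := by linarith
    exact_mod_cast this

lemma coeff_linearDop_pow_monomial_eq_zero {g m : ℕ} (hm : 2 * m + 1 ≤ g) (k : ℕ)
    {d : ℕ →₀ ℕ} (hc : codimW d = g) (hl : 1 ≤ levelW d) :
    coeff (Finsupp.single m 1) ((linearDop g ^ k) (monomial d 1)) = 0 := by
  by_contra hne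
  obtain ⟨hdeg, hlev⟩ := degree_levelW_of_coeff_linearDop_pow_ne_zero g k hne
  have hcd := codimW_eq_levelW_add_degree d
  have hlm : levelW (Finsupp.single m 1) = m := by simp [levelW]
  rw [Finsupp.degree_single] at hdeg
  have hd0 : d 0 ≠ 0 := fun h => by have := degree_le_levelW h; omega
  obtain ⟨u, rfl⟩ : ∃ u, d = Finsupp.single 0 1 + u :=
    exists_add_of_le (by simpa [Nat.one_le_iff_ne_zero] using hd0)
  have hu : u.degree + 1 = (Finsupp.single 0 1 + u).degree := by
    rw [map_add, Finsupp.degree_single, add_comm]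
  have hlu : levelW (Finsupp.single 0 1 + u) = levelW u := by
    rw [levelW, Finsupp.sum_add_index' (by simp) (by intros; ring)]
    simp [levelW]
  obtain ⟨j, rfl⟩ : ∃ j, k = j + 1 := ⟨k - 1, by omega⟩
  have hX : monomial (Finsupp.single 0 1 + u) (1 : ℚ) = X 0 * monomial u 1 := by
    rw [X, monomial_mul, one_mul]
  have hweight : (2 * (u.degree : ℚ) + 1 * levelW u) - g - j = 0 := by
    have : 2 * u.degree + levelW u = g + j := by omega
    have : ((2 * u.degree + levelW u : ℕ) : ℚ) = (g + j : ℕ) := by rw [this]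
    push_cast at this
    linarith
  have hm0 : m ≠ 0 := by omega
  apply hne
  rw [hX, linearDop_pow_X_zero_mul g (euler_affine_monomial 2 1 u), hweight, mul_zero, zero_smul,
    add_zero, coeff_X_mul', if_neg]
  simpa using hm0.symm

lemma Ipol_le_ker_lcoeff {g m : ℕ} (hm : 2 * m + 1 ≤ g) :
    Ipol g ≤ LinearMap.ker (lcoeff ℚ (Finsupp.single m 1)) := by
  refine sup_le (Submodule.span_le.2 ?_) (iSup_le fun k => Submodule.span_le.2 ?_)
  · rintro _ ⟨d, hd, rfl⟩
    simp only [SetLike.mem_coe, LinearMap.mem_ker, lcoeff_apply, coeff_monomial, ite_eq_right_iff]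
    rintro rfl
    simp [codimW] at hd
    omega
  · rintro _ ⟨p, hp, rfl⟩
    have hiter : (Dop g)^[k] p = (linearDop g ^ k) p := (Module.End.pow_apply (linearDop g) k p).symm
    rw [hiter]
    have hle : Fil1Rg g ≤
        LinearMap.ker (lcoeff ℚ (Finsupp.single m 1) ∘ₗ (linearDop g ^ k)) := by
      refine Submodule.span_le.2 ?_
      rintro _ ⟨d, hc, hl, rfl⟩
      exact coeff_linearDop_pow_monomial_eq_zero hm k hc hl
    exact hle hp

/-- for `1 ≤ n ≤ (g+1)/2` (i.e. `2n ≤ g+1`), the variable `x_n`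
does not lie in `I`; that is, its image in `𝓡 = R/I` is nonzero. -/
theorem stmt3 (g : ℕ) (hg : 3 ≤ g) (n : ℕ) (h1 : 1 ≤ n) (h2 : 2 * n ≤ g + 1) :
    X (n - 1) ∉ Ipol g := by
  intro h
  simpa using Ipol_le_ker_lcoeff (m := n - 1) (by omega) h
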